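/- arXiv:1711.05337 — 9 statements merged into one kernel-verified Lean document; each statement's English description precedes it below -/
import Mathlib

section
/- Let S : ℝ^D → ℝ^D be a linear involution and let f, g : ℝ^D → ℝ^D be continuously differentiable vector fields that are both S-reversible, i.e. S ∘ f = −f ∘ S and S ∘ g = −g ∘ S. Then their Lie bracket [f,g], defined by [f,g](x) = g'(x)f(x) − f'(x)g(x), satisfies [f,g](S(x)) = S([f,g](x)) for all x ∈ ℝ^D. -/
/-- Differentiating the reversibility relation `L ∘ f = -f ∘ L`. -/
theorem map_fderiv_of_reversible {E : Type*} [NormedAddCommGroup E] [NormedSpace ℝ E]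
    (L : E →L[ℝ] E) {f : E → E} (hf : Differentiable ℝ f) (hrev : ∀ x, L (f x) = -f (L x))
    (x v : E) : L (fderiv ℝ f x v) = -fderiv ℝ f (L x) (L v) := by
  have hl : HasFDerivAt (fun y => L (f y)) (L.comp (fderiv ℝ f x)) x :=
    L.hasFDerivAt.comp x (hf x).hasFDerivAt
  have hr : HasFDerivAt (fun y => -f (L y)) (-(fderiv ℝ f (L x)).comp L) x :=
    ((hf (L x)).hasFDerivAt.comp x L.hasFDerivAt).neg
  rw [← funext hrev] at hr
  exact DFunLike.congr_fun (hl.unique hr) v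

/-- If `S` is a linear involution of `ℝ^D` and `f`, `g` are `C¹`
vector fields that are both `S`-reversible (`S ∘ f = -f ∘ S`, `S ∘ g = -g ∘ S`), then their
Lie bracket `[f,g](x) = g'(x) f(x) - f'(x) g(x)` satisfies `[f,g](S x) = S ([f,g] x)`. -/
theorem lieBracket_of_reversible
    (D : ℕ) (S : (Fin D → ℝ) →ₗ[ℝ] (Fin D → ℝ)) (hS : ∀ x, S (S x) = x)
    (f g : (Fin D → ℝ) → (Fin D → ℝ))
    (hf : ContDiff ℝ 1 f) (hg : ContDiff ℝ 1 g)
    (hfrev : ∀ x, S (f x) = -f (S x)) (hgrev : ∀ x, S (g x) = -g (S x)) :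
    ∀ x, fderiv ℝ g (S x) (f (S x)) - fderiv ℝ f (S x) (g (S x))
        = S (fderiv ℝ g x (f x) - fderiv ℝ f x (g x)) := by
  intro x
  have key := fun {h : (Fin D → ℝ) → (Fin D → ℝ)} (hh : ContDiff ℝ 1 h)
      (hrev : ∀ x, S (h x) = -h (S x)) (v : Fin D → ℝ) =>
    map_fderiv_of_reversible (LinearMap.toContinuousLinearMap S)
      (hh.differentiable one_ne_zero) hrev x v
  simp only [LinearMap.coe_toContinuousLinearMap'] at key
  rw [map_sub, key hg hgrev, key hf hfrev, hfrev, hgrev, map_neg, map_neg, neg_neg, neg_neg]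
end

section
/- Let S : ℝ^D → ℝ^D be a linear involution, let ρ : ℝ^D → (0,∞) be a Lebesgue-integrable density with ρ ∘ S = ρ, and let Φ : ℝ^D → ℝ^D be a continuously differentiable bijection with differentiable inverse that is reversible with respect to S (S ∘ Φ = Φ⁻¹ ∘ S). Define the acceptance probability α(x) = min{1, (ρ(Φ(x))/ρ(x)) |det Φ'(x)|} and the Markov transition kernel Π_x = α(x) δ_{Φ(x)} + (1 − α(x)) δ_{S(x)}, where δ_y is the Dirac measure at y. Then the measure with density ρ is invariant for this kernel: for every measurable set A ⊆ ℝ^D, ∫_{ℝ^D} Π_x(A) ρ(x) dx = ∫_A ρ(x) dx. -/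
open MeasureTheory

/-- Acceptance probability of the Metropolized reversible map:
`α(x) = min{1, (ρ(Φ x)/ρ x) |det Φ'(x)|}`. -/
noncomputable def acceptanceProbability (D : ℕ) (ρ : (Fin D → ℝ) → ℝ)
    (Φ : (Fin D → ℝ) → (Fin D → ℝ)) (x : Fin D → ℝ) : ℝ :=
  min 1 (ρ (Φ x) / ρ x * |(fderiv ℝ Φ x).det|)

theorem integral_abs_det_mul_comp_involutive {E : Type*} [NormedAddCommGroup E]
    [NormedSpace ℝ E] [FiniteDimensional ℝ E] [MeasurableSpace E] [BorelSpace E]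
    (μ : Measure E) [μ.IsAddHaarMeasure] {T : E → E} {T' : E → E →L[ℝ] E}
    (hT : Function.Involutive T) (hT' : ∀ x, HasFDerivAt T (T' x) x) (f : E → ℝ) :
    ∫ x, |(T' x).det| * f (T x) ∂μ = ∫ x, f x ∂μ := by
  have h := integral_image_eq_integral_abs_det_fderiv_smul μ MeasurableSet.univ
    (fun x _ => (hT' x).hasFDerivWithinAt) hT.injective.injOn f
  simpa [Set.image_univ, hT.surjective.range_eq] using h.symm

theorem det_fderiv_mul_det_fderiv_of_involutive {E : Type*} [NormedAddCommGroup E]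
    [NormedSpace ℝ E] {T : E → E} {T' : E → E →L[ℝ] E}
    (hT : Function.Involutive T) (hT' : ∀ x, HasFDerivAt T (T' x) x) (x : E) :
    (T' (T x)).det * (T' x).det = 1 := by
  have h := (hT' (T x)).comp x (hT' x)
  rw [hT.comp_self] at h
  have h' := h.unique (hasFDerivAt_id x)
  have := congrArg ContinuousLinearMap.det h'
  simpa [ContinuousLinearMap.det, LinearMap.det_comp] using this

theorem abs_det_of_involutive {E : Type*} [AddCommGroup E] [Module ℝ E] {S : E →ₗ[ℝ] E}
    (hS : Function.Involutive S) : |LinearMap.det S| = 1 := by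
  have h : S ∘ₗ S = LinearMap.id := LinearMap.ext hS
  have h' := congrArg LinearMap.det h
  rw [LinearMap.det_comp, LinearMap.det_id] at h'
  have h'' : |LinearMap.det S| * |LinearMap.det S| = 1 := by rw [← abs_mul, h', abs_one]
  nlinarith [abs_nonneg (LinearMap.det S)]

/-- Let `S` be a linear involution of `ℝ^D`, `ρ` a positive integrable
density with `ρ ∘ S = ρ`, and `Φ` a `C¹` bijection with differentiable inverse, reversible
with respect to `S`.  The Metropolis kernel `Π_x = α(x) δ_{Φ(x)} + (1-α(x)) δ_{S(x)}`
leaves the measure with density `ρ` invariant: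
`∫ Π_x(A) ρ(x) dx = ∫_A ρ(x) dx` for every measurable `A`. -/
theorem metropolized_reversible_map_invariant
    (D : ℕ) (S : (Fin D → ℝ) →ₗ[ℝ] (Fin D → ℝ)) (hS : ∀ x, S (S x) = x)
    (ρ : (Fin D → ℝ) → ℝ) (hρpos : ∀ x, 0 < ρ x) (hρmeas : Measurable ρ)
    (hρint : Integrable ρ) (hρS : ∀ x, ρ (S x) = ρ x)
    (Φ : (Fin D → ℝ) ≃ (Fin D → ℝ)) (hΦ : ContDiff ℝ 1 ⇑Φ)
    (hΦinv : Differentiable ℝ ⇑Φ.symm)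
    (hrev : ∀ x, S (Φ x) = Φ.symm (S x)) :
    ∀ A : Set (Fin D → ℝ), MeasurableSet A →
      ∫ x, (acceptanceProbability D ρ Φ x * A.indicator (fun _ => (1 : ℝ)) (Φ x)
          + (1 - acceptanceProbability D ρ Φ x) * A.indicator (fun _ => (1 : ℝ)) (S x)) * ρ x
        = ∫ x in A, ρ x := by
  intro A hA
  set J : (Fin D → ℝ) → ℝ := fun x => |(fderiv ℝ Φ x).det| with hJ
  set T : (Fin D → ℝ) → (Fin D → ℝ) := fun x => S (Φ x) with hTdef
  set m : (Fin D → ℝ) → ℝ := fun x => min (ρ x) (ρ (T x) * J x) with hm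
  set g : (Fin D → ℝ) → ℝ := fun x => A.indicator (fun _ => (1 : ℝ)) (S x) with hg
  have hT : Function.Involutive T := fun x => by
    change S (Φ (S (Φ x))) = x
    rw [hrev, hS, Φ.symm_apply_apply]
  have hScont : Continuous S := S.continuous_of_finiteDimensional
  have hT' : ∀ x, HasFDerivAt T (S.toContinuousLinearMap.comp (fderiv ℝ Φ x)) x := fun x =>
    S.toContinuousLinearMap.hasFDerivAt.comp x
      ((hΦ.differentiable one_ne_zero) x).hasFDerivAt
  have hdetS : |LinearMap.det S| = 1 := abs_det_of_involutive hS
  have hdet : ∀ x, |(S.toContinuousLinearMap.comp (fderiv ℝ Φ x)).det| = J x := fun x => by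
    simp [ContinuousLinearMap.det, LinearMap.det_comp, abs_mul, hdetS, hJ]
  have hJmul : ∀ x, J (T x) * J x = 1 := fun x => by
    rw [← hdet, ← hdet, ← abs_mul, det_fderiv_mul_det_fderiv_of_involutive hT hT', abs_one]
  have hJnonneg : ∀ x, 0 ≤ J x := fun x => abs_nonneg _
  have hmT : ∀ x, J x * m (T x) = m x := fun x => by
    simp only [hm, hT x]
    rw [mul_min_of_nonneg _ _ (hJnonneg x), mul_left_comm, mul_comm (J x) (J (T x)), hJmul,
      mul_one, min_comm, mul_comm]
  have hαρ : ∀ x, acceptanceProbability D ρ Φ x * ρ x = m x := fun x => by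
    simp only [acceptanceProbability, hm, hTdef, hρS, hJ]
    rw [min_mul_of_nonneg _ _ (hρpos x).le, one_mul, mul_right_comm,
      div_mul_cancel₀ _ (hρpos x).ne']
  have hJcont : Continuous J :=
    (ContinuousLinearMap.continuous_det.comp (hΦ.continuous_fderiv one_ne_zero)).abs
  have hTcont : Continuous T := hScont.comp hΦ.continuous
  have hmint : Integrable m := by
    refine hρint.mono' (hρmeas.min
      ((hρmeas.comp hTcont.measurable).mul hJcont.measurable)).aestronglyMeasurable
      (Filter.Eventually.of_forall fun x => ?_)
    rw [Real.norm_of_nonneg (le_min (hρpos x).le (mul_nonneg (hρpos _).le (hJnonneg x)))]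
    exact min_le_left _ _
  have hgmeas : Measurable g :=
    (measurable_const.indicator hA).comp hScont.measurable
  have hgbound : ∀ x, ‖g x‖ ≤ 1 := fun x =>
    (norm_indicator_le_norm_self _ _).trans (by simp)
  have hmul_g : ∀ {f : (Fin D → ℝ) → ℝ}, Integrable f → Integrable fun x => f x * g x :=
    fun hf => hf.mul_bdd hgmeas.aestronglyMeasurable (Filter.Eventually.of_forall hgbound)
  have hmgT : (fun x => |(S.toContinuousLinearMap.comp (fderiv ℝ Φ x)).det| *
      (m (T x) * g (T x))) = fun x => m x * g (T x) := by
    ext x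
    rw [hdet, ← mul_assoc, hmT]
  have hmgTint : Integrable fun x => m x * g (T x) :=
    hmint.mul_bdd (hgmeas.comp hTcont.measurable).aestronglyMeasurable
      (Filter.Eventually.of_forall fun x => hgbound (T x))
  have hproposal : ∫ x, m x * g (T x) = ∫ x, m x * g x := by
    rw [← hmgT]
    exact integral_abs_det_mul_comp_involutive volume hT hT' fun x => m x * g x
  have hflip : ∫ x, ρ x * g x = ∫ x in A, ρ x := by
    have h := integral_abs_det_mul_comp_involutive volume (T := S) hS
      (fun _ => S.toContinuousLinearMap.hasFDerivAt) (A.indicator ρ)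
    rw [← integral_indicator hA, ← h]
    congr 1 with x
    by_cases hx : S x ∈ A <;> simp [hg, hx, hρS, ContinuousLinearMap.det, hdetS]
  calc
    _ = ∫ x, (m x * g (T x) + (ρ x * g x - m x * g x)) := by
      congr 1 with x
      rw [← hαρ]
      simp only [hg, hTdef, hS]
      ring
    _ = ∫ x in A, ρ x := by
      have hdiff : Integrable fun x => ρ x * g x - m x * g x :=
        (hmul_g hρint).sub (hmul_g hmint)
      rw [integral_add hmgTint hdiff, integral_sub (hmul_g hρint) (hmul_g hmint), hproposal, hflip]
      ring
end

section
/- Let Ψ : ℝ^{2d} → ℝ^{2d} be a bijection that preserves Lebesgue measure and is reversible with respect to the momentum flip involution S(q,p) = (q,−p), i.e. S ∘ Ψ = Ψ⁻¹ ∘ S. Let H : ℝ^{2d} → ℝ be measurable with H ∘ S = H, and set Δ(q,p) = H(Ψ(q,p)) − H(q,p). Then for any odd measurable function g : ℝ → ℝ, ∫_{ℝ^{2d}} g(Δ(q,p)) e^{−H(q,p)} dq dp = −∫_{ℝ^{2d}} g(Δ(q,p)) e^{−H(Ψ(q,p))} dq dp, provided one of the integrals exists; and for any even measurable g, ∫_{ℝ^{2d}}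 g(Δ(q,p)) e^{−H(q,p)} dq dp = ∫_{ℝ^{2d}} g(Δ(q,p)) e^{−H(Ψ(q,p))} dq dp, provided one of the integrals exists. -/
open MeasureTheory

/-- Flipping the sign of the second component preserves Lebesgue measure. -/
theorem measurePreserving_momentumFlip (d : ℕ) :
    MeasurePreserving (fun x : (Fin d → ℝ) × (Fin d → ℝ) => (x.1, -x.2)) volume volume :=
  (MeasurePreserving.id volume).prod (Measure.measurePreserving_neg volume)

/-- A measure-preserving involution leaves Bochner integrals unchanged. -/
theorem MeasureTheory.MeasurePreserving.integral_comp_of_involutive {α : Type*}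
    [MeasurableSpace α] {μ : Measure α} {T : α → α} (hT : MeasurePreserving T μ μ)
    (hinv : Function.Involutive T) (f : α → ℝ) : ∫ x, f (T x) ∂μ = ∫ x, f x ∂μ :=
  MeasurePreserving.integral_comp' (f := MeasurableEquiv.ofInvolutive T hinv hT.measurable) hT f

/-- Let `Ψ` be a volume-preserving bijection of `ℝ^d × ℝ^d`, reversible
with respect to the momentum flip `S(q,p) = (q,-p)`, and let `H` be measurable with
`H ∘ S = H`.  Set `Δ = H ∘ Ψ - H`.  Then, provided one of the integrals exists, for odd `g`
`∫ g(Δ) e^{-H} = -∫ g(Δ) e^{-H∘Ψ}` and for even `g` `∫ g(Δ) e^{-H} = ∫ g(Δ) e^{-H∘Ψ}`. -/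
theorem energy_error_parity_integrals
    (d : ℕ) (Ψ : ((Fin d → ℝ) × (Fin d → ℝ)) ≃ ((Fin d → ℝ) × (Fin d → ℝ)))
    (hΨ : MeasurePreserving Ψ volume volume)
    (hrev : ∀ x : (Fin d → ℝ) × (Fin d → ℝ), ((Ψ x).1, -(Ψ x).2) = Ψ.symm (x.1, -x.2))
    (H : (Fin d → ℝ) × (Fin d → ℝ) → ℝ) (hH : Measurable H)
    (hHS : ∀ x : (Fin d → ℝ) × (Fin d → ℝ), H (x.1, -x.2) = H x)
    (g : ℝ → ℝ) (hg : Measurable g)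
    (hInt : Integrable (fun x => g (H (Ψ x) - H x) * Real.exp (-H x)) ∨
        Integrable (fun x => g (H (Ψ x) - H x) * Real.exp (-H (Ψ x)))) :
    ((∀ t, g (-t) = -g t) →
      ∫ x, g (H (Ψ x) - H x) * Real.exp (-H x)
        = -∫ x, g (H (Ψ x) - H x) * Real.exp (-H (Ψ x))) ∧
    ((∀ t, g (-t) = g t) →
      ∫ x, g (H (Ψ x) - H x) * Real.exp (-H x)
        = ∫ x, g (H (Ψ x) - H x) * Real.exp (-H (Ψ x))) := by
  have hinv : Function.Involutive fun x => ((Ψ x).1, -(Ψ x).2) := by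
    intro x
    have h := hrev ((Ψ x).1, -(Ψ x).2)
    simpa using h
  have hT : MeasurePreserving (fun x => ((Ψ x).1, -(Ψ x).2)) volume volume :=
    (measurePreserving_momentumFlip d).comp hΨ
  have hHΨ : ∀ x, H (Ψ ((Ψ x).1, -(Ψ x).2)) = H x := fun x => by
    rw [← hHS]
    exact congrArg H (hinv x)
  have key : ∫ x, g (H (Ψ x) - H x) * Real.exp (-H x) =
      ∫ x, g (-(H (Ψ x) - H x)) * Real.exp (-H (Ψ x)) := by
    rw [← hT.integral_comp_of_involutive hinv]
    simp only [hHΨ, hHS, neg_sub]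
  refine ⟨fun hodd => ?_, fun heven => ?_⟩
  · simp only [key, hodd, neg_mul, integral_neg]
  · simp only [key, heven]
end

section
/- Let Ψ : ℝ^{2d} → ℝ^{2d} be a bijection that preserves Lebesgue measure and is reversible with respect to the momentum flip involution S(q,p) = (q,−p). Let H : ℝ^{2d} → ℝ be measurable with H ∘ S = H, and set Δ(q,p) = H(Ψ(q,p)) − H(q,p). If the integral m_Δ = ∫_{ℝ^{2d}} Δ(q,p) e^{−H(q,p)} dq dp exists, then 0 ≤ m_Δ ≤ ∫_{ℝ^{2d}} Δ(q,p)² e^{−H(q,p)} dq dp. Moreover the first inequality is strict unless Δ vanishes almost everywhere. -/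
open MeasureTheory

lemma sub_mul_exp_neg_sub_nonneg (a b : ℝ) :
    0 ≤ (b - a) * (Real.exp (-a) - Real.exp (-b)) := by
  rcases le_total a b with h | h
  · exact mul_nonneg (sub_nonneg.2 h) (sub_nonneg.2 (Real.exp_le_exp.2 (neg_le_neg h)))
  · exact mul_nonneg_of_nonpos_of_nonpos (sub_nonpos.2 h)
      (sub_nonpos.2 (Real.exp_le_exp.2 (neg_le_neg h)))

lemma eq_of_sub_mul_exp_neg_sub_eq_zero {a b : ℝ}
    (h : (b - a) * (Real.exp (-a) - Real.exp (-b)) = 0) : b - a = 0 := by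
  rcases mul_eq_zero.1 h with h | h
  · exact h
  · have := Real.exp_injective (sub_eq_zero.1 h)
    linarith

lemma exp_neg_sub_le (a b : ℝ) :
    Real.exp (-a) - Real.exp (-b) ≤ (b - a) * Real.exp (-a) := by
  have h : Real.exp (-b) = Real.exp (-a) * Real.exp (a - b) := by
    rw [← Real.exp_add]; ring_nf
  rw [h]
  nlinarith [Real.add_one_le_exp (a - b), Real.exp_pos (-a)]

lemma sub_mul_exp_neg_sub_le (a b : ℝ) :
    (b - a) * (Real.exp (-a) - Real.exp (-b))
      ≤ (b - a) ^ 2 * Real.exp (-a) + (a - b) ^ 2 * Real.exp (-b) := by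
  have ha : 0 ≤ (b - a) ^ 2 * Real.exp (-a) := by positivity
  have hb : 0 ≤ (a - b) ^ 2 * Real.exp (-b) := by positivity
  rcases le_total a b with h | h
  · nlinarith [mul_le_mul_of_nonneg_left (exp_neg_sub_le a b) (sub_nonneg.2 h)]
  · nlinarith [mul_le_mul_of_nonneg_left (exp_neg_sub_le b a) (sub_nonneg.2 h)]

/-- The mean energy error bounds for a measure-preserving involution of a measure space. -/
theorem mean_energy_error_bounds_of_involutive {X : Type*} [MeasurableSpace X] {μ : Measure X}
    {T : X → X} (hT : MeasurePreserving T μ μ) (hinv : Function.Involutive T)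
    {H : X → ℝ} (hH : Measurable H)
    (hInt : Integrable (fun x => (H (T x) - H x) * Real.exp (-H x)) μ) :
    0 ≤ (∫ x, (H (T x) - H x) * Real.exp (-H x) ∂μ) ∧
    ENNReal.ofReal (∫ x, (H (T x) - H x) * Real.exp (-H x) ∂μ)
      ≤ (∫⁻ x, ENNReal.ofReal ((H (T x) - H x) ^ 2 * Real.exp (-H x)) ∂μ) ∧
    ((∫ x, (H (T x) - H x) * Real.exp (-H x) ∂μ) = 0 → ∀ᵐ x ∂μ, H (T x) - H x = 0) := by
  have hemb : MeasurableEmbedding T :=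
    (MeasurableEquiv.ofInvolutive T hinv hT.measurable).measurableEmbedding
  set m := ∫ x, (H (T x) - H x) * Real.exp (-H x) ∂μ with hm
  have hInt' : Integrable (fun x => (H x - H (T x)) * Real.exp (-H (T x))) μ := by
    simpa only [Function.comp_def, hinv _] using (hT.integrable_comp_emb hemb).2 hInt
  have hm' : ∫ x, (H x - H (T x)) * Real.exp (-H (T x)) ∂μ = m := by
    simpa only [hinv _] using
      hT.integral_comp hemb (fun x => (H (T x) - H x) * Real.exp (-H x))
  have hsum : (fun x => (H (T x) - H x) * (Real.exp (-H x) - Real.exp (-H (T x)))) =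
      fun x => (H (T x) - H x) * Real.exp (-H x) + (H x - H (T x)) * Real.exp (-H (T x)) := by
    funext x; ring
  have hIntS : Integrable
      (fun x => (H (T x) - H x) * (Real.exp (-H x) - Real.exp (-H (T x)))) μ := by
    rw [hsum]; exact hInt.add hInt'
  have h2m : ∫ x, (H (T x) - H x) * (Real.exp (-H x) - Real.exp (-H (T x))) ∂μ = 2 * m := by
    rw [hsum, integral_add hInt hInt', hm', ← hm, two_mul]
  have hnn : ∀ x, 0 ≤ (H (T x) - H x) * (Real.exp (-H x) - Real.exp (-H (T x))) :=
    fun x => sub_mul_exp_neg_sub_nonneg _ _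
  have hm0 : 0 ≤ m := by
    have h : 0 ≤ 2 * m := h2m ▸ integral_nonneg hnn
    linarith
  refine ⟨hm0, ?_, fun h0 => ?_⟩
  · set L := ∫⁻ x, ENNReal.ofReal ((H (T x) - H x) ^ 2 * Real.exp (-H x)) ∂μ with hL
    have hL' : ∫⁻ x, ENNReal.ofReal ((H x - H (T x)) ^ 2 * Real.exp (-H (T x))) ∂μ = L := by
      simpa only [hinv _] using hT.lintegral_comp_emb hemb
        (fun x => ENNReal.ofReal ((H (T x) - H x) ^ 2 * Real.exp (-H x)))
    have hHT : Measurable fun x => H (T x) := hH.comp hT.measurable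
    have hle : 2 * ENNReal.ofReal m ≤ 2 * L := by
      calc 2 * ENNReal.ofReal m = ENNReal.ofReal (2 * m) := by
            rw [ENNReal.ofReal_mul zero_le_two, ENNReal.ofReal_ofNat]
        _ = ∫⁻ x, ENNReal.ofReal
              ((H (T x) - H x) * (Real.exp (-H x) - Real.exp (-H (T x)))) ∂μ := by
            rw [← h2m, ofReal_integral_eq_lintegral_ofReal hIntS (ae_of_all _ hnn)]
        _ ≤ ∫⁻ x, (ENNReal.ofReal ((H (T x) - H x) ^ 2 * Real.exp (-H x)) +
              ENNReal.ofReal ((H x - H (T x)) ^ 2 * Real.exp (-H (T x)))) ∂μ := by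
            refine lintegral_mono fun x => ?_
            rw [← ENNReal.ofReal_add (by positivity) (by positivity)]
            exact ENNReal.ofReal_le_ofReal (sub_mul_exp_neg_sub_le _ _)
        _ = 2 * L := by
            rw [lintegral_add_left (by fun_prop), hL', ← hL, two_mul]
    exact (ENNReal.mul_le_mul_iff_right two_ne_zero ENNReal.ofNat_ne_top).1 hle
  · rw [h0, mul_zero, integral_eq_zero_iff_of_nonneg hnn hIntS] at h2m
    filter_upwards [h2m] with x hx
    exact eq_of_sub_mul_exp_neg_sub_eq_zero hx

/-- Let `Ψ` be a volume-preserving bijection of `ℝ^d × ℝ^d`, reversible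
with respect to the momentum flip, and `H` measurable with `H ∘ S = H`.  Set
`Δ = H ∘ Ψ - H`.  If `m_Δ = ∫ Δ e^{-H}` exists, then `0 ≤ m_Δ ≤ ∫ Δ² e^{-H}`, and the
first inequality is strict unless `Δ` vanishes almost everywhere. -/
theorem mean_energy_error_bounds
    (d : ℕ) (Ψ : ((Fin d → ℝ) × (Fin d → ℝ)) ≃ ((Fin d → ℝ) × (Fin d → ℝ)))
    (hΨ : MeasurePreserving Ψ volume volume)
    (hrev : ∀ x : (Fin d → ℝ) × (Fin d → ℝ), ((Ψ x).1, -(Ψ x).2) = Ψ.symm (x.1, -x.2))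
    (H : (Fin d → ℝ) × (Fin d → ℝ) → ℝ) (hH : Measurable H)
    (hHS : ∀ x : (Fin d → ℝ) × (Fin d → ℝ), H (x.1, -x.2) = H x)
    (hInt : Integrable (fun x => (H (Ψ x) - H x) * Real.exp (-H x))) :
    0 ≤ (∫ x, (H (Ψ x) - H x) * Real.exp (-H x)) ∧
    ENNReal.ofReal (∫ x, (H (Ψ x) - H x) * Real.exp (-H x))
      ≤ (∫⁻ x, ENNReal.ofReal ((H (Ψ x) - H x) ^ 2 * Real.exp (-H x))) ∧
    ((∫ x, (H (Ψ x) - H x) * Real.exp (-H x)) = 0 →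
      ∀ᵐ x : (Fin d → ℝ) × (Fin d → ℝ), H (Ψ x) - H x = 0) := by
  have hflip : MeasurePreserving
      (fun x : (Fin d → ℝ) × (Fin d → ℝ) => (x.1, -x.2)) volume volume :=
    (MeasurePreserving.id volume).prod (Measure.measurePreserving_neg volume)
  have hinv : Function.Involutive fun x => ((Ψ x).1, -(Ψ x).2) := fun x => by
    have h := hrev ((Ψ x).1, -(Ψ x).2)
    simpa only [neg_neg, Prod.mk.eta, Equiv.symm_apply_apply] using h
  have h := mean_energy_error_bounds_of_involutive (hflip.comp hΨ) hinv hH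
  simp only [Function.comp_apply, hHS] at h
  exact h hInt
end

section
/- Let θ ∈ ℝ with sin θ ≠ 0, let χ ≠ 0, and let M̃ be the 2×2 matrix [[cos θ, χ sin θ],[−χ⁻¹ sin θ, cos θ]]. For n ∈ ℕ and (q₀,p₀) ∈ ℝ², let (q_n,p_n)ᵀ = M̃ⁿ (q₀,p₀)ᵀ and define the energy error Δ(q₀,p₀) = (1/2)(q_n² + p_n²) − (1/2)(q₀² + p₀²). Then: if χ² ≥ 1, Δ(q₀,p₀) ≤ (1/2)(χ² − 1) p₀² for all (q₀,p₀); and if χ² ≤ 1, Δ(q₀,p₀) ≤ (1/2)(1/χ² − 1) q₀² for all (q₀,p₀). -/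
open Matrix

/-- Multiplication by the one-step matrix preserves the quadratic form `q² + χ² p²`. -/
theorem oneStep_mulVec_preserves_ellipse (θ : ℝ) {χ : ℝ} (hχ : χ ≠ 0) (w : Fin 2 → ℝ) :
    let w' := !![Real.cos θ, χ * Real.sin θ; -χ⁻¹ * Real.sin θ, Real.cos θ].mulVec w
    w' 0 ^ 2 + χ ^ 2 * w' 1 ^ 2 = w 0 ^ 2 + χ ^ 2 * w 1 ^ 2 := by
  simp only [mulVec, dotProduct, Fin.sum_univ_two, of_apply, cons_val_zero, cons_val_one]
  field_simp
  linear_combination (w 0 ^ 2 + χ ^ 2 * w 1 ^ 2) * Real.sin_sq_add_cos_sq θ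

/-- Every iterate of the one-step matrix preserves the quadratic form `q² + χ² p²`. -/
theorem oneStep_pow_mulVec_preserves_ellipse (θ : ℝ) {χ : ℝ} (hχ : χ ≠ 0) (n : ℕ)
    (w : Fin 2 → ℝ) :
    let w' := (!![Real.cos θ, χ * Real.sin θ; -χ⁻¹ * Real.sin θ, Real.cos θ] ^ n).mulVec w
    w' 0 ^ 2 + χ ^ 2 * w' 1 ^ 2 = w 0 ^ 2 + χ ^ 2 * w 1 ^ 2 := by
  induction n with
  | zero => simp
  | succ n ih =>
    rw [pow_succ', ← mulVec_mulVec]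
    exact (oneStep_mulVec_preserves_ellipse θ hχ _).trans ih

/-- For the one-step matrix
`M̃ = [[cos θ, χ sin θ],[−χ⁻¹ sin θ, cos θ]]` (with `sin θ ≠ 0`, `χ ≠ 0`), the energy error
after `n` steps of the integrator applied to the harmonic oscillator satisfies the uniform
pointwise bounds `Δ ≤ (1/2)(χ² − 1) p₀²` when `χ² ≥ 1`, and `Δ ≤ (1/2)(1/χ² − 1) q₀²`
when `χ² ≤ 1`. -/
theorem harmonic_pointwise_energy_error_bound
    (θ χ : ℝ) (hθ : Real.sin θ ≠ 0) (hχ : χ ≠ 0) (n : ℕ) (q₀ p₀ : ℝ) :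
    let M : Matrix (Fin 2) (Fin 2) ℝ :=
      !![Real.cos θ, χ * Real.sin θ; -χ⁻¹ * Real.sin θ, Real.cos θ]
    let v := (M ^ n).mulVec ![q₀, p₀]
    let Δ := 1 / 2 * (v 0 ^ 2 + v 1 ^ 2) - 1 / 2 * (q₀ ^ 2 + p₀ ^ 2)
    (1 ≤ χ ^ 2 → Δ ≤ 1 / 2 * (χ ^ 2 - 1) * p₀ ^ 2) ∧
    (χ ^ 2 ≤ 1 → Δ ≤ 1 / 2 * (1 / χ ^ 2 - 1) * q₀ ^ 2) := by
  intro M v Δ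
  have hv : v 0 ^ 2 + χ ^ 2 * v 1 ^ 2 = q₀ ^ 2 + χ ^ 2 * p₀ ^ 2 :=
    oneStep_pow_mulVec_preserves_ellipse θ hχ n ![q₀, p₀]
  refine ⟨fun h => ?_, fun h => ?_⟩
  · have := mul_nonneg (sub_nonneg.2 h) (sq_nonneg (v 1))
    simp only [Δ]
    linarith
  · have hχ2 : 0 < χ ^ 2 := by positivity
    have hv' : 1 / χ ^ 2 * v 0 ^ 2 + v 1 ^ 2 = 1 / χ ^ 2 * q₀ ^ 2 + p₀ ^ 2 := by
      field_simp
      linarith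
    have := mul_nonneg (sub_nonneg.2 (one_le_one_div hχ2 h)) (sq_nonneg (v 0))
    simp only [Δ]
    linarith
end

section
/- Let θ ∈ ℝ with sin θ ≠ 0, let χ ≠ 0, and let M̃ = [[cos θ, χ sin θ],[−χ⁻¹ sin θ, cos θ]]. Let (q₀,p₀) be a random vector in ℝ² with (unnormalized) density exp(−(1/2)(q² + p²)) (i.e. q₀ and p₀ are independent standard Gaussians). For n ∈ ℕ, let (q_n,p_n)ᵀ = M̃ⁿ (q₀,p₀)ᵀ and Δ = (1/2)(q_n² + p_n²) − (1/2)(q₀² + p₀²). Then E(Δ) = sin²(nθ) · ρ, where ρ = (1/2)(χ² + 1/χ² − 2) = (1/2)(χ − 1/χ)² ≥ 0; consequently 0 ≤ E(Δ) ≤ ρ. -/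
open Matrix

open MeasureTheory ProbabilityTheory in
/-- Polynomial moments of the standard Gaussian density are finite. -/
lemma integrable_pow_mul_gaussianPDFReal_zero_one (k : ℕ) :
    Integrable fun x : ℝ => x ^ k * gaussianPDFReal 0 1 x := by
  have h := (integrable_rpow_mul_exp_neg_mul_sq (b := 1 / 2) (by norm_num)
    (s := k) (by linarith [k.cast_nonneg (α := ℝ)])).const_mul (√(2 * Real.pi))⁻¹
  refine h.congr (.of_forall fun x => ?_)
  simp only [gaussianPDFReal, Real.rpow_natCast, NNReal.coe_one, mul_one, sub_zero]
  rw [show -(1 / 2) * x ^ 2 = -x ^ 2 / 2 by ring]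
  ring

open MeasureTheory ProbabilityTheory in
lemma integral_mul_gaussianPDFReal (f : ℝ → ℝ) (μ : ℝ) {v : NNReal} (hv : v ≠ 0) :
    ∫ x, f x * gaussianPDFReal μ v x = ∫ x, f x ∂gaussianReal μ v := by
  simp only [integral_gaussianReal_eq_integral_smul hv, smul_eq_mul, mul_comm]

open MeasureTheory ProbabilityTheory in
lemma integral_sq_gaussianReal_zero_one : ∫ x, x ^ 2 ∂gaussianReal 0 1 = 1 := by
  have h := variance_fun_id_gaussianReal (μ := 0) (v := 1)
  rw [variance_of_integral_eq_zero (by fun_prop) (by simp)] at h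
  simpa using h

open MeasureTheory ProbabilityTheory in
/-- The mean of a quadratic form under the standard Gaussian density on the plane is its trace. -/
lemma integral_quadratic_mul_gaussian (a b c : ℝ) :
    ∫ x : ℝ × ℝ, (a * x.1 ^ 2 + b * (x.1 * x.2) + c * x.2 ^ 2) *
      ((2 * Real.pi)⁻¹ * Real.exp (-(x.1 ^ 2 + x.2 ^ 2) / 2)) = a + c := by
  let g (k : ℕ) (x : ℝ) : ℝ := x ^ k * gaussianPDFReal 0 1 x
  have hg (k l : ℕ) : Integrable fun x : ℝ × ℝ => g k x.1 * g l x.2 :=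
    (integrable_pow_mul_gaussianPDFReal_zero_one k).mul_prod
      (integrable_pow_mul_gaussianPDFReal_zero_one l)
  have hi (k l : ℕ) : ∫ x : ℝ × ℝ, g k x.1 * g l x.2 = (∫ x, g k x) * ∫ x, g l x :=
    integral_prod_mul (g k) (g l)
  have g0 : ∫ x, g 0 x = 1 := by
    simp [g, integral_gaussianPDFReal_eq_one]
  have g1 : ∫ x, g 1 x = 0 := by
    simp [g, integral_mul_gaussianPDFReal]
  have g2 : ∫ x, g 2 x = 1 := by
    simp only [g]
    rw [integral_mul_gaussianPDFReal _ _ one_ne_zero, integral_sq_gaussianReal_zero_one]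
  have hfun : (fun x : ℝ × ℝ => (a * x.1 ^ 2 + b * (x.1 * x.2) + c * x.2 ^ 2) *
      ((2 * Real.pi)⁻¹ * Real.exp (-(x.1 ^ 2 + x.2 ^ 2) / 2))) = fun x =>
      a * (g 2 x.1 * g 0 x.2) + b * (g 1 x.1 * g 1 x.2) + c * (g 0 x.1 * g 2 x.2) := by
    funext x
    have hs : (2 * Real.pi)⁻¹ = (√(2 * Real.pi))⁻¹ * (√(2 * Real.pi))⁻¹ := by
      rw [← mul_inv, Real.mul_self_sqrt (by positivity)]
    have he : Real.exp (-(x.1 ^ 2 + x.2 ^ 2) / 2) =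
        Real.exp (-x.1 ^ 2 / 2) * Real.exp (-x.2 ^ 2 / 2) := by
      rw [← Real.exp_add]
      ring_nf
    simp only [g, gaussianPDFReal, NNReal.coe_one, mul_one, sub_zero]
    rw [hs, he]
    ring
  have h20 := (hg 2 0).const_mul a
  have h11 := (hg 1 1).const_mul b
  rw [hfun, integral_add (by exact h20.add h11) ((hg 0 2).const_mul c), integral_add h20 h11]
  simp only [integral_const_mul, hi, g0, g1, g2]
  ring

/-- Powers of a rotation conjugated by the diagonal scaling `χ`. -/
lemma scaled_rotation_pow (θ : ℝ) {χ : ℝ} (hχ : χ ≠ 0) (n : ℕ) :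
    !![Real.cos θ, χ * Real.sin θ; -χ⁻¹ * Real.sin θ, Real.cos θ] ^ n =
      !![Real.cos (n * θ), χ * Real.sin (n * θ); -χ⁻¹ * Real.sin (n * θ), Real.cos (n * θ)] := by
  induction n with
  | zero => simp [Matrix.one_fin_two]
  | succ k ih =>
    rw [pow_succ, ih, Matrix.mul_fin_two]
    push_cast
    rw [add_mul, one_mul, Real.cos_add, Real.sin_add]
    ext i j
    fin_cases i <;> fin_cases j <;> simp <;> field_simp <;> ring

/-- For the one-step matrix
`M̃ = [[cos θ, χ sin θ],[−χ⁻¹ sin θ, cos θ]]` (with `sin θ ≠ 0`, `χ ≠ 0`), if `(q₀,p₀)` is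
distributed with (unnormalized) density `exp(−(q²+p²)/2)`, then the expected energy error
after `n` steps is `E(Δ) = sin²(nθ)·ρ` with `ρ = (1/2)(χ² + 1/χ² − 2) = (1/2)(χ − 1/χ)²`,
whence `0 ≤ E(Δ) ≤ ρ`. -/
theorem harmonic_mean_energy_error
    (θ χ : ℝ) (hθ : Real.sin θ ≠ 0) (hχ : χ ≠ 0) (n : ℕ) :
    let M : Matrix (Fin 2) (Fin 2) ℝ :=
      !![Real.cos θ, χ * Real.sin θ; -χ⁻¹ * Real.sin θ, Real.cos θ]
    let Δ : ℝ × ℝ → ℝ := fun x =>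
      1 / 2 * (((M ^ n).mulVec ![x.1, x.2]) 0 ^ 2 + ((M ^ n).mulVec ![x.1, x.2]) 1 ^ 2)
        - 1 / 2 * (x.1 ^ 2 + x.2 ^ 2)
    let ρ := 1 / 2 * (χ ^ 2 + 1 / χ ^ 2 - 2)
    ρ = 1 / 2 * (χ - 1 / χ) ^ 2 ∧ 0 ≤ ρ ∧
    (∫ x : ℝ × ℝ, Δ x * ((2 * Real.pi)⁻¹ * Real.exp (-(x.1 ^ 2 + x.2 ^ 2) / 2)))
      = Real.sin (n * θ) ^ 2 * ρ ∧
    0 ≤ (∫ x : ℝ × ℝ, Δ x * ((2 * Real.pi)⁻¹ * Real.exp (-(x.1 ^ 2 + x.2 ^ 2) / 2))) ∧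
    (∫ x : ℝ × ℝ, Δ x * ((2 * Real.pi)⁻¹ * Real.exp (-(x.1 ^ 2 + x.2 ^ 2) / 2))) ≤ ρ := by
  intro M Δ ρ
  have hρ : ρ = 1 / 2 * (χ - 1 / χ) ^ 2 := by
    simp only [ρ]
    field_simp
    ring
  have hρ0 : 0 ≤ ρ := by
    rw [hρ]
    positivity
  have hE : ∫ x : ℝ × ℝ, Δ x * ((2 * Real.pi)⁻¹ * Real.exp (-(x.1 ^ 2 + x.2 ^ 2) / 2)) =
      Real.sin (n * θ) ^ 2 * ρ := by
    have hΔ (x : ℝ × ℝ) : Δ x =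
        1 / 2 * (Real.cos (n * θ) ^ 2 + (χ⁻¹ * Real.sin (n * θ)) ^ 2 - 1) * x.1 ^ 2 +
        (χ - χ⁻¹) * Real.sin (n * θ) * Real.cos (n * θ) * (x.1 * x.2) +
        1 / 2 * ((χ * Real.sin (n * θ)) ^ 2 + Real.cos (n * θ) ^ 2 - 1) * x.2 ^ 2 := by
      simp only [Δ, M, scaled_rotation_pow θ hχ n, Matrix.mulVec, Matrix.of_apply,
        Matrix.cons_val_zero, Matrix.cons_val_one, Matrix.vec2_dotProduct]
      ring
    simp only [hΔ]
    rw [integral_quadratic_mul_gaussian, Real.cos_sq']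
    simp only [ρ]
    ring
  rw [hE]
  exact ⟨hρ, hρ0, rfl, mul_nonneg (sq_nonneg _) hρ0,
    mul_le_of_le_one_left hρ0 (Real.sin_sq_le_one _)⟩
end

section
/- Let σ > 0 and let X be a real Gaussian random variable with mean σ²/2 and variance σ². Then E[min{1, e^{−X}}] = 2Φ(−σ/2), where Φ(x) = (2π)^{−1/2} ∫_{−∞}^x e^{−ξ²/2} dξ is the standard normal cumulative distribution function. -/
open MeasureTheory ProbabilityTheory

/-- If the mean is half the variance, weighting the Gaussian density by `min 1 (exp (-x))`
replaces its argument by `-|x|`. -/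
lemma gaussianPDFReal_mul_min_one_exp_neg {v : NNReal} (hv : v ≠ 0) (x : ℝ) :
    gaussianPDFReal (v / 2) v x * min 1 (Real.exp (-x)) =
      gaussianPDFReal (v / 2) v (-|x|) := by
  have hv' : (v : ℝ) ≠ 0 := by exact_mod_cast hv
  rcases le_total x 0 with hx | hx
  · rw [min_eq_left (Real.one_le_exp (by linarith)), abs_of_nonpos hx, neg_neg, mul_one]
  · rw [min_eq_right (Real.exp_le_one_iff.2 (by linarith)), abs_of_nonneg hx]
    simp only [gaussianPDFReal]
    rw [mul_assoc, ← Real.exp_add]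
    congr 2
    field_simp
    ring

/-- Translating a half-line integral. -/
lemma setIntegral_Ioi_comp_add_right (g : ℝ → ℝ) (a d : ℝ) :
    ∫ x in Set.Ioi a, g (x + d) = ∫ x in Set.Ioi (a + d), g x := by
  rw [← (measurePreserving_add_right volume d).setIntegral_preimage_emb
    (measurableEmbedding_addRight d) g (Set.Ioi (a + d))]
  simp

/-- If `X` is a real Gaussian random variable with mean `σ²/2` and
variance `σ²` (`σ > 0`), then `E[min{1, e^{−X}}] = 2Φ(−σ/2)`, where `Φ` is the standard
normal cumulative distribution function. -/
theorem expected_acceptance_probability (σ : ℝ) (hσ : 0 < σ) :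
    (∫ x, min 1 (Real.exp (-x)) ∂(gaussianReal (σ ^ 2 / 2) ⟨σ ^ 2, sq_nonneg σ⟩))
      = 2 * ((Real.sqrt (2 * Real.pi))⁻¹ *
          ∫ ξ in Set.Iic (-σ / 2), Real.exp (-ξ ^ 2 / 2)) := by
  obtain ⟨v, hv_eq, hvσ⟩ : ∃ v : NNReal, v = ⟨σ ^ 2, sq_nonneg σ⟩ ∧ (v : ℝ) = σ ^ 2 :=
    ⟨_, rfl, rfl⟩
  rw [← hv_eq, ← hvσ]
  have hv : v ≠ 0 := by
    rintro rfl
    exact (pow_pos hσ 2).ne hvσ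
  have hpdf (x : ℝ) : gaussianPDFReal (v / 2) v (-x) =
      (Real.sqrt (2 * Real.pi))⁻¹ * (σ⁻¹ * Real.exp (-(σ⁻¹ * x + σ / 2) ^ 2 / 2)) := by
    simp only [gaussianPDFReal, hvσ]
    rw [Real.sqrt_mul (by positivity), Real.sqrt_sq hσ.le, mul_inv, mul_assoc]
    congr 3
    field_simp
    ring
  have hscale := integral_comp_mul_left_Ioi
    (fun y ↦ Real.exp (-(y + σ / 2) ^ 2 / 2)) 0 (inv_pos.2 hσ)
  have hreflect := integral_comp_neg_Iic (-σ / 2) (fun ξ : ℝ ↦ Real.exp (-ξ ^ 2 / 2))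
  simp only [neg_sq] at hreflect
  rw [integral_gaussianReal_eq_integral_smul hv]
  calc
    _ = ∫ x, gaussianPDFReal (v / 2) v (-|x|) :=
      integral_congr_ae (.of_forall fun x ↦ gaussianPDFReal_mul_min_one_exp_neg hv x)
    _ = _ := by
      rw [integral_comp_abs (f := fun x ↦ gaussianPDFReal (v / 2) v (-x))]
      simp only [hpdf, integral_const_mul]
      rw [hscale, setIntegral_Ioi_comp_add_right (fun y ↦ Real.exp (-y ^ 2 / 2)), hreflect,
        smul_eq_mul, inv_inv, inv_mul_cancel_left₀ hσ.ne', mul_zero, zero_add, neg_div, neg_neg]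
end

section
/- Fix ω > 0 and c ∈ [0,1]. For h > 0, let M̃_{h,c} be the 2×2 one-step matrix of the splitting integrator for the Hamiltonian H(q,p) = (1/2)ω⁻²p² + (1/2)(ω²+1)q²: for c ∈ (0,1], M̃_{h,c} = [[cos(ch) − (h ω̃²/(2cω²)) sin(ch), sin(ch)/(cω²)], [−h ω̃² cos(ch) − ((4c²ω⁴ − h²ω̃⁴)/(4cω²)) sin(ch), cos(ch) − (h ω̃²/(2cω²)) sin(ch)]] with ω̃² = 1 + (1−c²)ω²; and for c = 0, M̃_{h,0} = [[1 − (h²/(2ω²))(1+ω²), h/ω²], [h(1+ω²)(h² − (4−h²)ω²)/(4ω²), 1 − (h²/(2ω²))(1+ω²)]]. If c ∈ (0,1] and h satisfies c h + 2 arctan( h(1 + (1−c²)ω²) / (2cω²) ) < π, then |trace(M̃_{h,c})| < 2, so (since det M̃_{h,c} = 1) the powers M̃_{h,c}ⁿ remain bounded as n → ∞. If c = 0 and h < 2ω/√(1+ω²), the same conclusion holds. -/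
open Matrix

/-- One-step matrix of the PHMC splitting integrator with parameter `c ∈ [0,1]` applied to
the model Hamiltonian `H(q,p) = (1/2)ω⁻²p² + (1/2)(ω²+1)q²`. -/
noncomputable def phmcMatrix (ω c h : ℝ) : Matrix (Fin 2) (Fin 2) ℝ :=
  if c = 0 then
    !![1 - h ^ 2 / (2 * ω ^ 2) * (1 + ω ^ 2), h / ω ^ 2;
       h * (1 + ω ^ 2) * (h ^ 2 - (4 - h ^ 2) * ω ^ 2) / (4 * ω ^ 2),
       1 - h ^ 2 / (2 * ω ^ 2) * (1 + ω ^ 2)]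
  else
    !![Real.cos (c * h) -
         h * (1 + (1 - c ^ 2) * ω ^ 2) / (2 * c * ω ^ 2) * Real.sin (c * h),
       Real.sin (c * h) / (c * ω ^ 2);
       -(h * (1 + (1 - c ^ 2) * ω ^ 2)) * Real.cos (c * h) -
         (4 * c ^ 2 * ω ^ 4 - h ^ 2 * (1 + (1 - c ^ 2) * ω ^ 2) ^ 2) / (4 * c * ω ^ 2) *
           Real.sin (c * h),
       Real.cos (c * h) -
         h * (1 + (1 - c ^ 2) * ω ^ 2) / (2 * c * ω ^ 2) * Real.sin (c * h)]

theorem Matrix.exists_pow_eq_smul_sub_smul_one {R : Type*} [CommRing R]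
    {M : Matrix (Fin 2) (Fin 2) R} (hdet : M.det = 1) (n : ℕ) :
    ∃ u v : R, M ^ n = u • M - v • (1 : Matrix (Fin 2) (Fin 2) R) ∧
      u ^ 2 - M.trace * u * v + v ^ 2 = 1 := by
  have hsq : M * M = M.trace • M - (1 : Matrix (Fin 2) (Fin 2) R) := by
    rw [det_fin_two] at hdet
    ext i j
    fin_cases i <;> fin_cases j <;>
      simp [mul_apply, Fin.sum_univ_two, trace_fin_two] <;>
      first | ring1 | linear_combination -hdet
  induction n with
  | zero => exact ⟨0, -1, by simp, by ring⟩
  | succ n ih =>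
    obtain ⟨u, v, hpow, hinv⟩ := ih
    refine ⟨u * M.trace - v, u, ?_, by linear_combination hinv⟩
    rw [pow_succ, hpow, sub_mul, smul_mul_assoc, smul_mul_assoc, one_mul, hsq]
    module

/-- A real `2 × 2` matrix of determinant one with `|trace| < 2` has bounded powers. -/
theorem Matrix.exists_abs_pow_apply_le {M : Matrix (Fin 2) (Fin 2) ℝ} (hdet : M.det = 1)
    (htr : |M.trace| < 2) : ∃ C : ℝ, ∀ n : ℕ, ∀ i j, |(M ^ n) i j| ≤ C := by
  set K : ℝ := √(4 / (4 - M.trace ^ 2))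
  have hpos : 0 < 4 - M.trace ^ 2 := by nlinarith [abs_lt.mp htr]
  have hbound {u v : ℝ} (h : u ^ 2 - M.trace * u * v + v ^ 2 = 1) : |u| ≤ K := by
    refine Real.abs_le_sqrt ((le_div_iff₀ hpos).mpr ?_)
    nlinarith [sq_nonneg (2 * v - M.trace * u)]
  refine ⟨K * (∑ i, ∑ j, |M i j|) + K, fun n i j => ?_⟩
  obtain ⟨u, v, hpow, hinv⟩ := exists_pow_eq_smul_sub_smul_one hdet n
  have hu : |u| ≤ K := hbound hinv
  have hv : |v| ≤ K := hbound (v := u) (by linear_combination hinv)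
  have hM : |M i j| ≤ ∑ i, ∑ j, |M i j| :=
    (Finset.single_le_sum (f := fun j => |M i j|) (fun _ _ => abs_nonneg _)
      (Finset.mem_univ j)).trans
      (Finset.single_le_sum (f := fun i => ∑ j, |M i j|)
        (fun _ _ => Finset.sum_nonneg fun _ _ => abs_nonneg _) (Finset.mem_univ i))
  have hone : |(1 : Matrix (Fin 2) (Fin 2) ℝ) i j| ≤ 1 := by
    rw [one_apply]; split_ifs <;> simp
  have hK : 0 ≤ K := Real.sqrt_nonneg _
  calc |(M ^ n) i j| = |u * M i j - v * (1 : Matrix (Fin 2) (Fin 2) ℝ) i j| := by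
        rw [hpow]; simp
    _ ≤ |u| * |M i j| + |v| * |(1 : Matrix (Fin 2) (Fin 2) ℝ) i j| := by
        simpa only [abs_mul] using abs_sub (u * M i j) (v * (1 : Matrix (Fin 2) (Fin 2) ℝ) i j)
    _ ≤ K * (∑ i, ∑ j, |M i j|) + K * 1 := by gcongr
    _ = _ := by rw [mul_one]

theorem Real.abs_cos_sub_mul_sin_lt_one {k x : ℝ} (hk : 0 ≤ k) (hx : 0 < x)
    (h : x + 2 * arctan k < Real.pi) : |cos x - k * sin x| < 1 := by
  set θ := arctan k
  have hθ : 0 ≤ θ := arctan_nonneg.mpr hk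
  have hcos : 0 < cos θ := cos_arctan_pos k
  have hk' : k * cos θ = sin θ := by
    rw [← tan_arctan k, tan_mul_cos hcos.ne']
  have hsum : cos x - k * sin x = cos (x + θ) / cos θ := by
    rw [eq_div_iff hcos.ne', cos_add]
    linear_combination -sin x * hk'
  have hlt : cos (x + θ) < cos θ := cos_lt_cos_of_nonneg_of_le_pi hθ (by linarith) (by linarith)
  have hgt : cos (Real.pi - θ) < cos (x + θ) :=
    cos_lt_cos_of_nonneg_of_le_pi (by linarith) (by linarith) (by linarith)
  rw [cos_pi_sub] at hgt
  rw [hsum, abs_div, abs_of_pos hcos, div_lt_one hcos, abs_lt]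
  exact ⟨hgt, hlt⟩

theorem det_phmcMatrix {ω : ℝ} (hω : ω ≠ 0) (c h : ℝ) : (phmcMatrix ω c h).det = 1 := by
  unfold phmcMatrix
  split_ifs with hc
  · rw [det_fin_two_of]
    field_simp
    ring
  · rw [det_fin_two_of, ← Real.sin_sq_add_cos_sq (c * h)]
    field_simp
    ring

/-- For `ω > 0`, `c ∈ [0,1]` and `h > 0` satisfying the stability
condition (`ch + 2 arctan(h(1+(1−c²)ω²)/(2cω²)) < π` for `c ∈ (0,1]`, and
`h < 2ω/√(1+ω²)` for `c = 0`), the one-step matrix of the PHMC splitting integrator has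
`|trace| < 2`, and hence (since its determinant is 1) its powers remain bounded. -/
theorem phmc_stability (ω c h : ℝ) (hω : 0 < ω) (hc : c ∈ Set.Icc (0 : ℝ) 1) (hh : 0 < h)
    (hstab₁ : c ≠ 0 →
      c * h + 2 * Real.arctan (h * (1 + (1 - c ^ 2) * ω ^ 2) / (2 * c * ω ^ 2)) < Real.pi)
    (hstab₂ : c = 0 → h < 2 * ω / Real.sqrt (1 + ω ^ 2)) :
    |(phmcMatrix ω c h).trace| < 2 ∧
    ∃ C : ℝ, ∀ n : ℕ, ∀ i j, |((phmcMatrix ω c h) ^ n) i j| ≤ C := by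
  have htr : |(phmcMatrix ω c h).trace| < 2 := by
    unfold phmcMatrix
    split_ifs with hc0
    · have hs : h ^ 2 * (1 + ω ^ 2) < 4 * ω ^ 2 := by
        have hlt := (lt_div_iff₀ (by positivity)).mp (hstab₂ hc0)
        have hsq := pow_lt_pow_left₀ hlt (by positivity) two_ne_zero
        rw [mul_pow, Real.sq_sqrt (by positivity)] at hsq
        linarith
      have heq : h ^ 2 / (2 * ω ^ 2) * (1 + ω ^ 2) = h ^ 2 * (1 + ω ^ 2) / (2 * ω ^ 2) := by ring
      have hpos : 0 < h ^ 2 * (1 + ω ^ 2) / (2 * ω ^ 2) := by positivity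
      have hlt : h ^ 2 * (1 + ω ^ 2) / (2 * ω ^ 2) < 2 := by
        rw [div_lt_iff₀ (by positivity)]
        linarith
      rw [trace_fin_two_of, heq, abs_lt]
      constructor <;> linarith
    · have hcpos : 0 < c := hc.1.lt_of_ne' hc0
      have hc2 : 0 ≤ 1 - c ^ 2 := by nlinarith [hc.2]
      have hlt := Real.abs_cos_sub_mul_sin_lt_one (by positivity) (mul_pos hcpos hh) (hstab₁ hc0)
      rw [trace_fin_two_of, ← two_mul, abs_mul, abs_two]
      linarith
  exact ⟨htr, exists_abs_pow_apply_le (det_phmcMatrix hω.ne' c h) htr⟩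
end

section
/- Fix ω > 0, c ∈ [0,1], and h > 0 satisfying the stability condition (c h + 2 arctan(h(1+(1−c²)ω²)/(2cω²)) < π if c ∈ (0,1]; h < 2ω/√(1+ω²) if c = 0). With θ_h, χ_h defined from the one-step matrix M̃_{h,c} of the PHMC splitting integrator, χ̂_h² = (ω² + ω⁴)χ_h², and ρ(c,ω,h) = (1/2)(χ̂_h − 1/χ̂_h)², the following identity holds: ρ(c,ω,h) = (1/2) · h⁴ r² / ((1 + ω⁻²)(1 + ω⁻² − h² r)), where r = r(c,ω,h) = (1/4)(1 − c² + ω⁻²)² + c²(1 − c² + ω⁻²) R(ch) and R(ζ) = (1 − ζ cot ζ)/ζ² (with R(0) interpreted as its limit 1/3 when c = 0). -/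
open Matrix

/-- `R(ζ) = (1 − ζ cot ζ)/ζ²`.  (With Lean's conventions `R(0) = 0`; in the statement
below `R(ch)` is always multiplied by `c²`, so the value at `0` is immaterial.) -/
noncomputable def Rfun (ζ : ℝ) : ℝ := (1 - ζ * (Real.cos ζ / Real.sin ζ)) / ζ ^ 2

/-- If `x = a / (a - e)` with `a` and `x` positive, then
`(√x - 1 / √x)² = e² / (a (a - e))`. -/
lemma sq_sqrt_sub_one_div_sqrt {x a e : ℝ} (ha : 0 < a) (hx : 0 < x)
    (h : x * (a - e) = a) :
    (√x - 1 / √x) ^ 2 = e ^ 2 / (a * (a - e)) := by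
  have hd : a - e ≠ 0 := fun h0 => by rw [h0, mul_zero] at h; exact ha.ne h
  have hx' : x = a / (a - e) := by rw [eq_div_iff hd, h]
  have hs : √x ≠ 0 := (Real.sqrt_pos.2 hx).ne'
  have hsq : (√x - 1 / √x) ^ 2 = x - 2 + 1 / x := by
    have h2 : √x ^ 2 = x := Real.sq_sqrt hx.le
    calc (√x - 1 / √x) ^ 2 = √x ^ 2 - 2 + 1 / √x ^ 2 := by field_simp; ring
      _ = x - 2 + 1 / x := by rw [h2]
  rw [hsq, hx']
  field_simp
  ring

/-- A step size below the stability limit satisfies `0 < sin (c h)`. -/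
lemma sin_pos_of_stable {ω c h : ℝ} (hω : 0 < ω) (hc : 0 < c) (hc1 : c ≤ 1) (hh : 0 < h)
    (hstab :
      c * h + 2 * Real.arctan (h * (1 + (1 - c ^ 2) * ω ^ 2) / (2 * c * ω ^ 2)) < Real.pi) :
    0 < Real.sin (c * h) := by
  have h1 : 0 ≤ 1 - c ^ 2 := by nlinarith
  have h2 : 0 ≤ Real.arctan (h * (1 + (1 - c ^ 2) * ω ^ 2) / (2 * c * ω ^ 2)) :=
    Real.arctan_nonneg.2 (by positivity)
  exact Real.sin_pos_of_pos_of_lt_pi (by positivity) (by linarith)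

/-- For a stable step size, with `θ_h`, `χ_h` defined from the PHMC
one-step matrix, `χ̂_h² = (ω²+ω⁴)χ_h²` and `ρ = (1/2)(χ̂_h − 1/χ̂_h)²`, one has the
representation `ρ = (1/2) h⁴ r² / ((1+ω⁻²)(1+ω⁻² − h²r))`, where
`r = (1/4)(1−c²+ω⁻²)² + c²(1−c²+ω⁻²) R(ch)` and `R(ζ) = (1−ζ cot ζ)/ζ²`. -/
theorem phmc_rho_representation
    (ω c h : ℝ) (hω : 0 < ω) (hc : c ∈ Set.Icc (0 : ℝ) 1) (hh : 0 < h)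
    (hstab₁ : c ≠ 0 →
      c * h + 2 * Real.arctan (h * (1 + (1 - c ^ 2) * ω ^ 2) / (2 * c * ω ^ 2)) < Real.pi)
    (hstab₂ : c = 0 → h < 2 * ω / Real.sqrt (1 + ω ^ 2))
    (θh χh : ℝ)
    (hcos : Real.cos θh = (phmcMatrix ω c h).trace / 2)
    (hsin : Real.sin θh ≠ 0)
    (hχ : χh = if c = 0 then h / (ω ^ 2 * Real.sin θh)
        else Real.sin (c * h) / (c * ω ^ 2 * Real.sin θh)) :
    let χhat := Real.sqrt ((ω ^ 2 + ω ^ 4) * χh ^ 2)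
    let r := 1 / 4 * (1 - c ^ 2 + (ω ^ 2)⁻¹) ^ 2 +
      c ^ 2 * (1 - c ^ 2 + (ω ^ 2)⁻¹) * Rfun (c * h)
    1 / 2 * (χhat - 1 / χhat) ^ 2
      = 1 / 2 * (h ^ 4 * r ^ 2) / ((1 + (ω ^ 2)⁻¹) * (1 + (ω ^ 2)⁻¹ - h ^ 2 * r)) := by
  intro χhat r
  have ha : 0 < 1 + (ω ^ 2)⁻¹ := by positivity
  suffices hmain : 0 < (ω ^ 2 + ω ^ 4) * χh ^ 2 ∧
      (ω ^ 2 + ω ^ 4) * χh ^ 2 * (1 + (ω ^ 2)⁻¹ - h ^ 2 * r) = 1 + (ω ^ 2)⁻¹ by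
    rw [sq_sqrt_sub_one_div_sqrt ha hmain.1 hmain.2]
    ring
  have hsq := Real.sin_sq_add_cos_sq θh
  rw [hcos, Matrix.trace_fin_two] at hsq
  by_cases hc0 : c = 0
  · subst hc0
    simp only [phmcMatrix, if_true, Matrix.of_apply, Matrix.cons_val', Matrix.cons_val_zero,
      Matrix.cons_val_one, Matrix.cons_val_fin_one] at hsq hχ
    have hχ0 : χh ≠ 0 := by rw [hχ]; positivity
    refine ⟨by positivity, ?_⟩
    have hD : 1 + (ω ^ 2)⁻¹ - h ^ 2 * r = Real.sin θh ^ 2 / h ^ 2 := by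
      rw [eq_sub_of_add_eq hsq]
      simp only [r]
      field_simp
      ring
    rw [hD, hχ]
    field_simp
    ring
  · have hs := sin_pos_of_stable hω (lt_of_le_of_ne hc.1 (Ne.symm hc0)) hc.2 hh (hstab₁ hc0)
    simp only [phmcMatrix, if_neg hc0, Matrix.of_apply, Matrix.cons_val', Matrix.cons_val_zero,
      Matrix.cons_val_one, Matrix.cons_val_fin_one] at hsq hχ
    have hχ0 : χh ≠ 0 := by rw [hχ]; positivity
    refine ⟨by positivity, ?_⟩
    have hC : Real.cos (c * h) ^ 2 = 1 - Real.sin (c * h) ^ 2 := Real.cos_sq' _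
    have hD : 1 + (ω ^ 2)⁻¹ - h ^ 2 * r =
        Real.sin θh ^ 2 * c ^ 2 / Real.sin (c * h) ^ 2 := by
      rw [eq_sub_of_add_eq hsq]
      simp only [r, Rfun]
      generalize Real.cos (c * h) = C at *
      generalize Real.sin (c * h) = s at *
      field_simp
      linear_combination (64 * ω ^ 4 * c ^ 2) * hC
    rw [hD, hχ]
    field_simp
    ring
end
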